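/- Let p be an odd prime and suppose that the multiplicative order t of 2 in (ℤ/pℤ)^× is even. Then the real numbers csc(2πk/p) for k = 1, …, (p−1)/2 are linearly independent over ℚ: if a_1, …, a_{(p−1)/2} are rational numbers with Σ_{k=1}^{(p−1)/2} a_k · csc(2πk/p) = 0, then all a_k = 0. -/

import Mathlib

/-- On `[c, ∞)` with `c > 0`, the map `x ↦ x ^ (-s)` is Lipschitz with constant `s * c ^ (-s - 1)`. -/
theorem abs_rpow_neg_sub_rpow_neg_le {c u v s : ℝ} (hc : 0 < c) (hu : c ≤ u) (hv : c ≤ v)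
    (hs : 0 ≤ s) : |u ^ (-s) - v ^ (-s)| ≤ s * c ^ (-s - 1) * |u - v| := by
  have key := (convex_Ici c).norm_image_sub_le_of_norm_hasDerivWithin_le
    (f := fun x : ℝ ↦ x ^ (-s)) (f' := fun x ↦ -s * x ^ (-s - 1)) (C := s * c ^ (-s - 1))
    (fun x hx ↦ (Real.hasDerivAt_rpow_const
      (Or.inl (hc.trans_le hx).ne')).hasDerivWithinAt) ?_ hv hu
  · simpa [Real.norm_eq_abs] using key
  · intro x hx
    have hx0 : 0 < x := hc.trans_le hx
    rw [Real.norm_eq_abs, abs_mul, abs_neg, abs_of_nonneg hs,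
      abs_of_pos (Real.rpow_pos_of_pos hx0 _)]
    gcongr ?_ * ?_
    exact Real.rpow_le_rpow_of_nonpos hc hx (by linarith)

theorem norm_one_div_cpow_sub_one_div_cpow_le {a s : ℝ} (ha : 0 < a) (ha' : a < 1)
    (hs : 1 ≤ s) (hs' : s ≤ 2) (n : ℕ) :
    ‖(1 / (n + a : ℂ) ^ (s : ℂ) - 1 / (n + 1 - a : ℂ) ^ (s : ℂ)) / 2‖ ≤
      (min a (1 - a)) ^ (-3 : ℝ) * (1 / ((n + 1 : ℕ) : ℝ) ^ 2) := by
  set m := min a (1 - a) with hm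
  have hm0 : 0 < m := lt_min ha (by linarith)
  have hma : m ≤ a := min_le_left _ _
  have hma' : m ≤ 1 - a := min_le_right _ _
  have hn : (0 : ℝ) ≤ n := n.cast_nonneg
  have hc : 0 < m * (n + 1) := by positivity
  have hu : m * (n + 1) ≤ n + a := by nlinarith
  have hv : m * (n + 1) ≤ n + 1 - a := by nlinarith
  have hreal : (1 / (n + a : ℂ) ^ (s : ℂ) - 1 / (n + 1 - a : ℂ) ^ (s : ℂ)) / 2 =
      ((((n + a) ^ (-s) - (n + 1 - a) ^ (-s)) / 2 : ℝ) : ℂ) := by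
    rw [Real.rpow_neg (by linarith), Real.rpow_neg (by linarith)]
    push_cast [Complex.ofReal_cpow (hc.le.trans hu), Complex.ofReal_cpow (hc.le.trans hv)]
    simp only [one_div]
  rw [hreal, Complex.norm_real, Real.norm_eq_abs, abs_div, abs_two]
  have h1 := abs_rpow_neg_sub_rpow_neg_le hc hu hv (by linarith : 0 ≤ s)
  have h2 : |(n + a : ℝ) - (n + 1 - a)| ≤ 1 := by rw [abs_le]; constructor <;> linarith
  have h3 : (m * (n + 1)) ^ (-s - 1) ≤ m ^ (-3 : ℝ) * (1 / ((n + 1 : ℕ) : ℝ) ^ 2) := by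
    rw [Real.mul_rpow hm0.le (by positivity)]
    gcongr ?_ * ?_
    · exact Real.rpow_le_rpow_of_exponent_ge hm0 (by linarith) (by linarith)
    · rw [one_div, ← Real.rpow_natCast, ← Real.rpow_neg (by positivity)]
      push_cast
      exact Real.rpow_le_rpow_of_exponent_le (by linarith) (by linarith)
  have h4 : 0 < (m * (n + 1)) ^ (-s - 1) := by positivity
  have h5 : s * (m * (n + 1)) ^ (-s - 1) * |(n + a : ℝ) - (n + 1 - a)| ≤
      2 * (m * (n + 1)) ^ (-s - 1) * 1 := by gcongr
  linarith

theorem summable_one_div_add_one_sq_mul (c : ℝ) :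
    Summable fun n : ℕ ↦ c * (1 / ((n + 1 : ℕ) : ℝ) ^ 2) :=
  ((summable_nat_add_iff 1).mpr (Real.summable_one_div_nat_pow.mpr one_lt_two)).mul_left c

/-- The value of the odd Hurwitz zeta function at `s = 1`, as a series. -/
theorem hasSum_hurwitzZetaOdd_one {a : ℝ} (ha : 0 < a) (ha' : a < 1) :
    HasSum (fun n : ℕ ↦ (1 / (n + a : ℂ) - 1 / (n + 1 - a : ℂ)) / 2)
      (HurwitzZeta.hurwitzZetaOdd a 1) := by
  have hsum := summable_one_div_add_one_sq_mul ((min a (1 - a)) ^ (-3 : ℝ))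
  have hS : Summable fun n : ℕ ↦ (1 / (n + a : ℂ) - 1 / (n + 1 - a : ℂ)) / 2 :=
    hsum.of_norm_bounded fun n ↦ by
      simpa using norm_one_div_cpow_sub_one_div_cpow_le ha ha' le_rfl one_le_two n
  have hlim : Filter.Tendsto
      (fun s : ℝ ↦ ∑' n : ℕ, (1 / (n + a : ℂ) ^ (s : ℂ) - 1 / (n + 1 - a : ℂ) ^ (s : ℂ)) / 2)
      (nhdsWithin 1 (Set.Ioi 1))
      (nhds (∑' n : ℕ, (1 / (n + a : ℂ) - 1 / (n + 1 - a : ℂ)) / 2)) := by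
    refine tendsto_tsum_of_dominated_convergence hsum (fun n ↦ ?_) ?_
    · have h1 : (n + a : ℂ) ≠ 0 := by
        have : (n + a : ℝ) ≠ 0 := by positivity
        exact_mod_cast this
      have h2 : (n + 1 - a : ℂ) ≠ 0 := by
        have : (n + 1 - a : ℝ) ≠ 0 := by
          have : (0 : ℝ) ≤ n := n.cast_nonneg
          linarith
        exact_mod_cast this
      have hcont : ContinuousAt (fun s : ℝ ↦
          (1 / (n + a : ℂ) ^ (s : ℂ) - 1 / (n + 1 - a : ℂ) ^ (s : ℂ)) / 2) 1 := by
        have e1 : ContinuousAt (fun s : ℝ ↦ (n + a : ℂ) ^ (s : ℂ)) 1 :=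
          Complex.continuous_ofReal.continuousAt.const_cpow (.inl h1)
        have e2 : ContinuousAt (fun s : ℝ ↦ (n + 1 - a : ℂ) ^ (s : ℂ)) 1 :=
          Complex.continuous_ofReal.continuousAt.const_cpow (.inl h2)
        exact ((continuousAt_const.div e1 (by simpa using h1)).sub
          (continuousAt_const.div e2 (by simpa using h2))).div_const 2
      simpa using hcont.tendsto.mono_left nhdsWithin_le_nhds
    · filter_upwards [Ioc_mem_nhdsGT one_lt_two] with s hs n
      exact norm_one_div_cpow_sub_one_div_cpow_le ha ha' hs.1.le hs.2 n
  have hzeta : Filter.Tendsto (fun s : ℝ ↦ HurwitzZeta.hurwitzZetaOdd a s)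
      (nhdsWithin 1 (Set.Ioi 1)) (nhds (HurwitzZeta.hurwitzZetaOdd a 1)) := by
    have := ((HurwitzZeta.differentiable_hurwitzZetaOdd a).continuous.comp
      Complex.continuous_ofReal).tendsto 1
    simpa [Function.comp_def] using this.mono_left nhdsWithin_le_nhds
  have heq := tendsto_nhds_unique (hzeta.congr' ?_) hlim
  · rw [heq]; exact hS.hasSum
  · filter_upwards [self_mem_nhdsWithin] with s hs
    exact (HurwitzZeta.hasSum_nat_hurwitzZetaOdd_of_mem_Icc ⟨ha.le, ha'.le⟩
      (by simpa using hs)).tsum_eq.symm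

theorem hurwitzZetaOdd_one {a : ℝ} (ha : 0 < a) (ha' : a < 1) :
    HurwitzZeta.hurwitzZetaOdd a 1 = Real.pi / 2 * Complex.cot (Real.pi * a) := by
  have hmem : (a : ℂ) ∈ Complex.integerComplement := by
    rintro ⟨n, hn⟩
    have hn' : (n : ℝ) = a := by exact_mod_cast hn
    rw [← hn'] at ha ha'
    have h0 : 0 < n := by exact_mod_cast ha
    have h1 : n < 1 := by exact_mod_cast ha'
    omega
  have h1 := (hasSum_hurwitzZetaOdd_one ha ha').tendsto_sum_nat
  have h2 := (summable_cotTerm hmem).hasSum.tendsto_sum_nat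
  have h3 : Filter.Tendsto (fun n : ℕ ↦ 1 / (a + n : ℂ)) Filter.atTop (nhds 0) := by
    have : Filter.Tendsto (fun n : ℕ ↦ (1 / (a + n : ℝ) : ℝ)) Filter.atTop (nhds 0) := by
      simp only [one_div]
      exact (Filter.tendsto_atTop_add_const_left _ a tendsto_natCast_atTop_atTop).inv_tendsto_atTop
    simpa [Function.comp_def] using (Complex.continuous_ofReal.tendsto 0).comp this
  have hpartial (N : ℕ) :
      ∑ n ∈ Finset.range N, (1 / (n + a : ℂ) - 1 / (n + 1 - a : ℂ)) / 2 =
        (∑ n ∈ Finset.range N, cotTerm a n + 1 / a - 1 / (a + N : ℂ)) / 2 := by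
    induction N with
    | zero => simp
    | succ N ih =>
      rw [Finset.sum_range_succ, ih, Finset.sum_range_succ, cotTerm,
        show (a - (N + 1) : ℂ) = -(N + 1 - a) by ring, div_neg]
      push_cast
      ring
  have h4 := ((h2.add_const (1 / (a : ℂ))).sub h3).div_const 2
  simp only [← hpartial] at h4
  have h5 : ∑' n, cotTerm (a : ℂ) n = Real.pi * Complex.cot (Real.pi * a) - 1 / a :=
    (cot_series_rep' hmem).symm
  rw [tendsto_nhds_unique h1 h4, h5]
  ring

section CotCsc

variable {p : ℕ}

/-- `cot (π k / p)` as a function of the residue `k` modulo `p`, with value `0` at `k = 0`. -/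
noncomputable def cotZMod (p : ℕ) (k : ZMod p) : ℝ := Real.cot (Real.pi * k.val / p)

/-- `csc (2 π k / p)` as a function of the residue `k` modulo `p`, with value `0` at `k = 0`. -/
noncomputable def cscZMod (p : ℕ) (k : ZMod p) : ℝ := (Real.sin (2 * Real.pi * k.val / p))⁻¹

theorem cscZMod_zero : cscZMod p 0 = 0 := by
  cases p <;> simp [cscZMod]

theorem cscZMod_natCast_of_lt {k : ℕ} (hk : k < p) :
    cscZMod p k = (Real.sin (2 * Real.pi * k / p))⁻¹ := by
  rw [cscZMod, ZMod.val_natCast_of_lt hk]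

theorem Real.cot_add_nat_mul_pi (x : ℝ) (n : ℕ) : Real.cot (x + n * Real.pi) = Real.cot x := by
  rw [Real.cot_eq_cos_div_sin, Real.cot_eq_cos_div_sin, Real.cos_add_nat_mul_pi,
    Real.sin_add_nat_mul_pi, mul_div_mul_left _ _ (pow_ne_zero _ (by norm_num))]

theorem Real.cot_sub_cot_two_mul (x : ℝ) :
    Real.cot x - Real.cot (2 * x) = (Real.sin (2 * x))⁻¹ := by
  rw [Real.cot_eq_cos_div_sin, Real.cot_eq_cos_div_sin, Real.cos_two_mul, Real.sin_two_mul]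
  rcases eq_or_ne (Real.sin x) 0 with hs | hs
  · simp [hs]
  rcases eq_or_ne (Real.cos x) 0 with hc | hc
  · simp [hc]
  field_simp
  ring

theorem cotZMod_natCast [NeZero p] (n : ℕ) : cotZMod p n = Real.cot (Real.pi * n / p) := by
  have hp : (p : ℝ) ≠ 0 := NeZero.ne _
  have hn : (n : ℝ) = (n % p : ℕ) + p * (n / p : ℕ) := by exact_mod_cast (Nat.mod_add_div n p).symm
  rw [cotZMod, ZMod.val_natCast, hn, ← Real.cot_add_nat_mul_pi _ (n / p)]
  congr 1
  field_simp

theorem cscZMod_eq_cotZMod_sub [NeZero p] (k : ZMod p) :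
    cscZMod p k = cotZMod p k - cotZMod p (2 * k) := by
  have h2 : cotZMod p (2 * k) = Real.cot (2 * (Real.pi * k.val / p)) := by
    have := cotZMod_natCast (p := p) (2 * k.val)
    rw [Nat.cast_mul, ZMod.natCast_zmod_val] at this
    rw [show (2 : ZMod p) = ((2 : ℕ) : ZMod p) by norm_num, this]
    push_cast
    congr 1
    ring
  rw [h2, cotZMod, Real.cot_sub_cot_two_mul, cscZMod]
  congr 2
  ring

theorem hurwitzZetaOdd_toAddCircle_one [NeZero p] {k : ZMod p} (hk : k ≠ 0) :
    HurwitzZeta.hurwitzZetaOdd (ZMod.toAddCircle k) 1 = Real.pi / 2 * cotZMod p k := by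
  have hp : (0 : ℝ) < p := Nat.cast_pos.mpr (NeZero.pos _)
  have hk0 : (0 : ℝ) < k.val := Nat.cast_pos.mpr (ZMod.val_pos.mpr hk)
  have hkp : (k.val : ℝ) < p := Nat.cast_lt.mpr k.val_lt
  rw [ZMod.toAddCircle_apply, hurwitzZetaOdd_one (by positivity) ((div_lt_one hp).mpr hkp),
    cotZMod, Complex.ofReal_cot]
  push_cast
  rw [mul_div_assoc]

theorem DirichletCharacter.sum_mul_cotZMod_ne_zero [NeZero p] (hp : p ≠ 1)
    {χ : DirichletCharacter ℂ p} (hχ : χ.Odd) : ∑ k, χ k * cotZMod p k ≠ 0 := by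
  have hne : χ ≠ 1 := by
    rintro rfl
    have h := hχ
    rw [DirichletCharacter.Odd, MulChar.one_apply isUnit_one.neg] at h
    norm_num at h
  have hL : DirichletCharacter.LFunction χ 1 ≠ 0 :=
    DirichletCharacter.LFunction_apply_one_ne_zero hne
  contrapose! hL
  have : Fact (1 < p) := ⟨by have := NeZero.pos p; omega⟩
  rw [DirichletCharacter.LFunction, ZMod.LFunction_def_odd hχ.to_fun]
  have : ∑ k : ZMod p, χ k * HurwitzZeta.hurwitzZetaOdd (ZMod.toAddCircle k) 1 =
      Real.pi / 2 * ∑ k, χ k * cotZMod p k := by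
    rw [Finset.mul_sum]
    refine Finset.sum_congr rfl fun k _ ↦ ?_
    rcases eq_or_ne k 0 with rfl | hk
    · simp [MulChar.map_zero χ]
    · rw [hurwitzZetaOdd_toAddCircle_one hk]; ring
  rw [this, hL]
  simp

theorem DirichletCharacter.sum_mul_apply_unit_mul [NeZero p] (χ : DirichletCharacter ℂ p)
    (u : (ZMod p)ˣ) (f : ZMod p → ℂ) : ∑ k, χ k * f (u * k) = χ⁻¹ u * ∑ k, χ k * f k := by
  rw [Finset.mul_sum, ← Equiv.sum_comp (Units.mulLeft u) (fun k ↦ χ⁻¹ (u : ZMod p) * (χ k * f k))]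
  refine Finset.sum_congr rfl fun k _ ↦ ?_
  rw [Units.mulLeft_apply, map_mul, ← mul_assoc, ← mul_assoc, ← MulChar.mul_apply,
    inv_mul_cancel, MulChar.one_apply u.isUnit, one_mul]

theorem DirichletCharacter.Odd.apply_two_ne_one [Fact p.Prime] {χ : DirichletCharacter ℂ p}
    (hχ : χ.Odd) (h2 : _root_.Even (orderOf (2 : ZMod p))) (hpos : orderOf (2 : ZMod p) ≠ 0) :
    χ 2 ≠ 1 := by
  intro h
  obtain ⟨m, hm⟩ := h2
  have hsq : ((2 : ZMod p) ^ m) * 2 ^ m = 1 := by rw [← pow_add, ← hm, pow_orderOf_eq_one]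
  rcases mul_self_eq_one_iff.mp hsq with h1 | h1
  · have := orderOf_dvd_of_pow_eq_one h1
    have := Nat.le_of_dvd (by omega) this
    omega
  · have hodd : χ (-1) = -1 := hχ
    rw [← h1, map_pow, h, one_pow] at hodd
    norm_num at hodd

theorem DirichletCharacter.sum_mul_cscZMod_ne_zero [Fact p.Prime] (hp : p ≠ 2)
    (h2 : _root_.Even (orderOf (2 : ZMod p))) {χ : DirichletCharacter ℂ p} (hχ : χ.Odd) :
    ∑ k, χ k * cscZMod p k ≠ 0 := by
  have htwo : (2 : ZMod p) ≠ 0 := by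
    intro h
    have := (ZMod.natCast_eq_zero_iff 2 p).mp (by exact_mod_cast h)
    exact hp ((Nat.prime_dvd_prime_iff_eq Fact.out Nat.prime_two).mp this)
  have hχ2 : χ 2 ≠ 1 := hχ.apply_two_ne_one h2
    (isOfFinOrder_iff_pow_eq_one.mpr ⟨p - 1, Nat.sub_pos_of_lt (Fact.out : p.Prime).one_lt,
      ZMod.pow_card_sub_one_eq_one htwo⟩).orderOf_pos.ne'
  have hsum := χ.sum_mul_apply_unit_mul (Units.mk0 2 htwo) fun k ↦ (cotZMod p k : ℂ)
  rw [Units.val_mk0] at hsum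
  have hinv : χ⁻¹ 2 ≠ 1 := by
    intro h
    have := MulChar.mul_apply χ χ⁻¹ 2
    rw [mul_inv_cancel, MulChar.one_apply htwo.isUnit, h, mul_one] at this
    exact hχ2 this.symm
  have heq : ∑ k, χ k * cscZMod p k = (1 - χ⁻¹ 2) * ∑ k, χ k * cotZMod p k := by
    rw [sub_mul, one_mul, ← hsum, ← Finset.sum_sub_distrib]
    refine Finset.sum_congr rfl fun k _ ↦ ?_
    rw [cscZMod_eq_cotZMod_sub]
    push_cast
    ring
  rw [heq]
  exact mul_ne_zero (sub_ne_zero.mpr hinv.symm)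
    (sum_mul_cotZMod_ne_zero (Fact.out : p.Prime).ne_one hχ)

end CotCsc

open Polynomial in
theorem IsPrimitiveRoot.aeval_eq_zero_of_aeval_eq_zero {K : Type*} [Field K] [CharZero K] {n : ℕ}
    (hn : 0 < n) {ζ ξ : K} (hζ : IsPrimitiveRoot ζ n) (hξ : IsPrimitiveRoot ξ n) {P : ℚ[X]}
    (hP : aeval ζ P = 0) : aeval ξ P = 0 := by
  rw [← minpoly.dvd_iff] at hP ⊢
  rwa [← cyclotomic_eq_minpoly_rat hξ hn, cyclotomic_eq_minpoly_rat hζ hn]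

theorem sub_one_mul_sum_range_mul_pow {R : Type*} [CommRing R] (w : R) (n : ℕ) :
    (w - 1) * ∑ r ∈ Finset.range n, (r : R) * w ^ r =
      n * w ^ n - w * ∑ r ∈ Finset.range n, w ^ r := by
  induction n with
  | zero => simp
  | succ n ih =>
    rw [Finset.sum_range_succ, mul_add, ih, Finset.sum_range_succ]
    push_cast
    ring

theorem inv_sub_one_eq_sum {K : Type*} [Field K] [CharZero K] {n : ℕ} (hn : n ≠ 0) {w : K}
    (hw : w ^ n = 1) (hw1 : w ≠ 1) :
    (w - 1)⁻¹ = (n : K)⁻¹ * ∑ r ∈ Finset.range n, (r : K) * w ^ r := by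
  have hn' : (n : K) ≠ 0 := Nat.cast_ne_zero.mpr hn
  have h0 : w - 1 ≠ 0 := sub_ne_zero.mpr hw1
  have hgeom : ∑ r ∈ Finset.range n, w ^ r = 0 := by
    refine (mul_eq_zero.mp ?_).resolve_left h0
    rw [mul_geom_sum, hw, sub_self]
  have h := sub_one_mul_sum_range_mul_pow w n
  rw [hgeom, hw] at h
  field_simp
  linear_combination -h

theorem Complex.ofReal_inv_sin (x : ℝ) :
    (((Real.sin x)⁻¹ : ℝ) : ℂ) = 2 * I * exp (x * I) * (exp (x * I) ^ 2 - 1)⁻¹ := by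
  have he : exp (x * I) ≠ 0 := exp_ne_zero _
  have : sin x = (exp (x * I) ^ 2 - 1) * (2 * I * exp (x * I))⁻¹ := by
    rw [sin, neg_mul, exp_neg, eq_mul_inv_iff_mul_eq₀ (by simp)]
    rw [mul_comm (x : ℂ) I]
    rw [mul_comm (x : ℂ) I] at he
    field_simp
    linear_combination (1 - exp (I * x) ^ 2) * I_sq
  rw [ofReal_inv, ofReal_sin, this, mul_inv, inv_inv, mul_comm]

section Galois

variable {p : ℕ}

theorem cscZMod_eq_sum [Fact p.Prime] (hp : p ≠ 2) {k : ZMod p} (hk : k ≠ 0) :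
    (cscZMod p k : ℂ) = 2 * Complex.I * (p : ℂ)⁻¹ *
      ∑ r ∈ Finset.range p, (r : ℂ) * ZMod.stdAddChar k ^ (2 * r + 1) := by
  have hpr : p.Prime := Fact.out
  have hexp : Complex.exp ((2 * Real.pi * k.val / p : ℝ) * Complex.I) = ZMod.stdAddChar k := by
    rw [ZMod.stdAddChar_apply, ZMod.toCircle_apply]
    push_cast
    congr 1
    ring
  have hpow : (ZMod.stdAddChar k ^ 2 : ℂ) ^ p = 1 := by
    rw [← AddChar.map_nsmul_eq_pow, ← AddChar.map_nsmul_eq_pow]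
    simp
  have hne : (ZMod.stdAddChar k ^ 2 : ℂ) ≠ 1 := by
    rw [← AddChar.map_nsmul_eq_pow, ← (ZMod.stdAddChar (N := p)).map_zero_eq_one]
    refine ZMod.injective_stdAddChar.ne ?_
    rw [nsmul_eq_mul]
    refine mul_ne_zero (fun h ↦ hp ?_) hk
    exact (Nat.prime_dvd_prime_iff_eq hpr Nat.prime_two).mp ((ZMod.natCast_eq_zero_iff 2 p).mp h)
  rw [cscZMod, Complex.ofReal_inv_sin, hexp, inv_sub_one_eq_sum hpr.ne_zero hpow hne,
    Finset.mul_sum, Finset.mul_sum, Finset.mul_sum]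
  refine Finset.sum_congr rfl fun r _ ↦ ?_
  ring

theorem ZMod.isPrimitiveRoot_stdAddChar [Fact p.Prime] {j : ZMod p} (hj : j ≠ 0) :
    IsPrimitiveRoot (ZMod.stdAddChar j : ℂ) p := by
  have hpow : (ZMod.stdAddChar j : ℂ) ^ p = 1 := by
    rw [← AddChar.map_nsmul_eq_pow]; simp
  refine IsPrimitiveRoot.iff_orderOf.mpr (orderOf_eq_prime hpow ?_)
  rw [← (ZMod.stdAddChar (N := p)).map_zero_eq_one]
  exact ZMod.injective_stdAddChar.ne hj

open Polynomial in
/-- A rational linear relation between the values `csc (2 π k / p)` is preserved by the Galois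
action `k ↦ j * k`. -/
theorem sum_mul_cscZMod_mul_eq_zero [Fact p.Prime] (hp : p ≠ 2) {f : ZMod p → ℚ}
    (hf : ∑ k, (f k : ℝ) * cscZMod p k = 0) (j : ZMod p) :
    ∑ k, (f k : ℝ) * cscZMod p (j * k) = 0 := by
  rcases eq_or_ne j 0 with rfl | hj
  · simp [cscZMod_zero]
  have hpr : p.Prime := Fact.out
  have hunit : 2 * Complex.I * (p : ℂ)⁻¹ ≠ 0 := by simp [hpr.ne_zero]
  let P : ℚ[X] := ∑ k ∈ Finset.univ.erase (0 : ZMod p), ∑ r ∈ Finset.range p,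
    C (f k * r) * X ^ (k.val * (2 * r + 1))
  have hval (i : ZMod p) (hi : i ≠ 0) : ((∑ k, (f k : ℝ) * cscZMod p (i * k) : ℝ) : ℂ) =
      2 * Complex.I * (p : ℂ)⁻¹ * aeval (ZMod.stdAddChar i : ℂ) P := by
    rw [← Finset.add_sum_erase _ _ (Finset.mem_univ 0), mul_zero, cscZMod_zero, mul_zero, zero_add,
      map_sum, Finset.mul_sum]
    push_cast
    refine Finset.sum_congr rfl fun k hk ↦ ?_
    rw [cscZMod_eq_sum hp (mul_ne_zero hi (Finset.ne_of_mem_erase hk)), map_sum, Finset.mul_sum,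
      Finset.mul_sum, Finset.mul_sum]
    refine Finset.sum_congr rfl fun r _ ↦ ?_
    have hik : (ZMod.stdAddChar (i * k) : ℂ) = ZMod.stdAddChar i ^ k.val := by
      rw [← AddChar.map_nsmul_eq_pow, nsmul_eq_mul, ZMod.natCast_zmod_val, mul_comm]
    rw [hik, ← pow_mul]
    simp only [map_mul, map_pow, aeval_X, aeval_C, eq_ratCast, Rat.cast_natCast]
    ring
  have h1 := hval 1 one_ne_zero
  simp only [one_mul, hf] at h1
  have hP : aeval (ZMod.stdAddChar (1 : ZMod p) : ℂ) P = 0 :=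
    (mul_eq_zero.mp (h1.symm.trans Complex.ofReal_zero)).resolve_left hunit
  have hPj := (ZMod.isPrimitiveRoot_stdAddChar (p := p) one_ne_zero).aeval_eq_zero_of_aeval_eq_zero
    hpr.pos (ZMod.isPrimitiveRoot_stdAddChar hj) hP
  have := hval j hj
  rw [hPj, mul_zero] at this
  exact_mod_cast this

end Galois

section Orthogonality

variable {p : ℕ}

theorem eq_zero_of_forall_sum_mul_char_eq_zero [Fact p.Prime] {g : ZMod p → ℂ}
    (hg : ∀ χ : DirichletCharacter ℂ p, ∑ k, g k * χ k = 0) {k : ZMod p} (hk : k ≠ 0) :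
    g k = 0 := by
  have h : ∑ χ : DirichletCharacter ℂ p, χ k⁻¹ * ∑ i, g i * χ i = 0 :=
    Finset.sum_eq_zero fun χ _ ↦ by rw [hg, mul_zero]
  simp_rw [Finset.mul_sum, mul_left_comm _ (g _)] at h
  rw [Finset.sum_comm] at h
  simp_rw [← Finset.mul_sum, DirichletCharacter.sum_char_inv_mul_char_eq ℂ hk.isUnit,
    mul_ite, mul_zero, Finset.sum_ite_eq, Finset.mem_univ, if_true] at h
  have hphi : (p.totient : ℂ) ≠ 0 := by
    simpa using (Fact.out : p.Prime).ne_zero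
  exact (mul_eq_zero.mp h).resolve_right hphi

theorem sum_mul_char_inv_eq_zero [Fact p.Prime] (hp : p ≠ 2)
    (h2 : Even (orderOf (2 : ZMod p))) {f : ZMod p → ℚ}
    (hf : ∑ k, (f k : ℝ) * cscZMod p k = 0) {χ : DirichletCharacter ℂ p} (hχ : χ.Odd) :
    ∑ k, (f k : ℂ) * χ⁻¹ k = 0 := by
  refine (mul_eq_zero.mp ?_).resolve_right
    (DirichletCharacter.sum_mul_cscZMod_ne_zero hp h2 hχ)
  have h : ∑ j, χ j * ∑ k, (f k : ℂ) * cscZMod p (j * k) = 0 := by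
    refine Finset.sum_eq_zero fun j _ ↦ ?_
    have := sum_mul_cscZMod_mul_eq_zero hp hf j
    have h' : ∑ k, (f k : ℂ) * cscZMod p (j * k) = 0 := by exact_mod_cast this
    rw [h', mul_zero]
  rw [Finset.sum_mul, ← h]
  conv_rhs =>
    simp only [Finset.mul_sum]
    rw [Finset.sum_comm]
  refine Finset.sum_congr rfl fun k _ ↦ ?_
  rcases eq_or_ne k 0 with rfl | hk
  · rw [MulChar.map_zero χ⁻¹]
    simp [cscZMod_zero]
  · have := χ.sum_mul_apply_unit_mul (Units.mk0 k hk) fun i ↦ (cscZMod p i : ℂ)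
    rw [Units.val_mk0] at this
    rw [mul_assoc, ← this, Finset.mul_sum]
    refine Finset.sum_congr rfl fun j _ ↦ ?_
    rw [mul_comm k j]
    ring

/-- Rational linear relations between the values `csc (2 π k / p)` are even in `k`. -/
theorem eq_apply_neg_of_sum_mul_cscZMod_eq_zero [Fact p.Prime] (hp : p ≠ 2)
    (h2 : Even (orderOf (2 : ZMod p))) {f : ZMod p → ℚ}
    (hf : ∑ k, (f k : ℝ) * cscZMod p k = 0) {k : ZMod p} (hk : k ≠ 0) : f k = f (-k) := by
  suffices h : ((f k : ℂ) - f (-k)) = 0 by exact_mod_cast sub_eq_zero.mp h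
  refine eq_zero_of_forall_sum_mul_char_eq_zero (g := fun k ↦ (f k : ℂ) - f (-k)) (fun χ ↦ ?_) hk
  have hneg : ∑ i, (f (-i) : ℂ) * χ i = χ (-1) * ∑ i, (f i : ℂ) * χ i := by
    rw [← Equiv.sum_comp (Equiv.neg (ZMod p)), Finset.mul_sum]
    refine Finset.sum_congr rfl fun i _ ↦ ?_
    rw [Equiv.neg_apply, neg_neg, ← neg_one_mul i, map_mul]
    ring
  simp_rw [sub_mul]
  rw [Finset.sum_sub_distrib, hneg]
  rcases χ.even_or_odd with hχ | hχ
  · rw [show χ (-1) = 1 from hχ, one_mul, sub_self]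
  · have hinv : (χ⁻¹).Odd := by
      rw [DirichletCharacter.Odd, MulChar.inv_apply', inv_neg, inv_one]
      exact hχ
    have := sum_mul_char_inv_eq_zero hp h2 hf hinv
    rw [inv_inv] at this
    rw [this, mul_zero, sub_zero]

end Orthogonality

/-- Let `p` be an odd prime and suppose the multiplicative order of `2` in
`(ℤ/pℤ)ˣ` is even.  Then the values `csc(2πk/p) = (sin(2πk/p))⁻¹`,
`k = 1, …, (p-1)/2`, are linearly independent over ℚ: any rational linear
combination of them that vanishes has all coefficients zero. -/
theorem csc_linearIndependent_of_even_order (p : ℕ) (hp : p.Prime) (hodd : Odd p)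
    (t : ℕ) (ht : t = orderOf (2 : ZMod p)) (hteven : Even t)
    (a : Fin ((p - 1) / 2) → ℚ)
    (h : ∑ k : Fin ((p - 1) / 2),
      (a k : ℝ) * (Real.sin (2 * Real.pi * (k.1 + 1) / p))⁻¹ = 0) :
    ∀ k, a k = 0 := by
  have : Fact p.Prime := ⟨hp⟩
  have hp2 : p ≠ 2 := by rintro rfl; exact absurd hodd (by decide)
  subst ht
  let f : ZMod p → ℚ := fun k ↦
    ∑ i : Fin ((p - 1) / 2), if ((i.1 + 1 : ℕ) : ZMod p) = k then a i else 0
  have hlt (i : Fin ((p - 1) / 2)) : i.1 + 1 < p := by omega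
  have hf : ∑ k, (f k : ℝ) * cscZMod p k = 0 := by
    rw [← h]
    simp only [f, Rat.cast_sum, Finset.sum_mul]
    rw [Finset.sum_comm]
    refine Finset.sum_congr rfl fun i _ ↦ ?_
    rw [Finset.sum_eq_single ((i.1 + 1 : ℕ) : ZMod p)
      (fun k _ hk ↦ by rw [if_neg hk.symm, Rat.cast_zero, zero_mul]) (by simp),
      if_pos rfl, cscZMod_natCast_of_lt (hlt i)]
    push_cast
    rfl
  intro i
  have hi0 : ((i.1 + 1 : ℕ) : ZMod p) ≠ 0 := by
    rw [Ne, ZMod.natCast_eq_zero_iff]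
    exact Nat.not_dvd_of_pos_of_lt (Nat.succ_pos _) (hlt i)
  have hfi : f (i.1 + 1 : ℕ) = a i := by
    refine (Finset.sum_eq_single i (fun j _ hji ↦ if_neg fun hj ↦ hji ?_) (by simp)).trans
      (if_pos rfl)
    rw [ZMod.natCast_eq_natCast_iff', Nat.mod_eq_of_lt (hlt j), Nat.mod_eq_of_lt (hlt i)] at hj
    exact Fin.ext (Nat.succ_injective hj)
  have hfni : f (-(i.1 + 1 : ℕ)) = 0 := by
    refine Finset.sum_eq_zero fun j _ ↦ if_neg fun hj ↦ ?_
    rw [eq_neg_iff_add_eq_zero, ← Nat.cast_add, ZMod.natCast_eq_zero_iff] at hj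
    exact Nat.not_dvd_of_pos_of_lt (by omega) (by omega) hj
  rw [← hfi, eq_apply_neg_of_sum_mul_cscZMod_eq_zero hp2 hteven hf hi0, hfni]
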